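/- arXiv:1905.06513 — 3 statements merged into one kernel-verified Lean document; each statement's English description precedes it below -/
import Mathlib

section
/- Let q be a power of an odd prime, let n be an even integer with 2 ≤ n ≤ q, and let a_1, …, a_n be distinct elements of F_q with S = {a_1, …, a_n}. Then there exist nonzero elements v_1, …, v_n of F_q such that the generalized Reed–Solomon code C_grs(S, v, q) = {(v_1 f(a_1), …, v_n f(a_n)) : f ∈ F_q[x], deg f ≤ n/2 − 1} ⊆ F_q^n is self-dual if and only if the values η_q(Δ_S(a_i)) are the same for all 1 ≤ i ≤ n. -/
open Finset Polynomial

/-- The generalized Reed–Solomon code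
C_grs(S,v,q) = {(v₁ f(a₁), …, vₙ f(aₙ)) : f ∈ F_q[x], deg f ≤ k − 1}. -/
def grsCode {F : Type*} [Field F] {n : ℕ} (a v : Fin n → F) (k : ℕ) : Set (Fin n → F) :=
  {c | ∃ f : Polynomial F, f.degree < (k : ℕ) ∧ c = fun i => v i * f.eval (a i)}

/-- The dual of a code C ⊆ F_q^n with respect to the standard inner product. -/
def dualSet {F : Type*} [Field F] {n : ℕ} (C : Set (Fin n → F)) : Set (Fin n → F) :=
  {w | ∀ c ∈ C, ∑ i, w i * c i = 0}

lemma delta_ne {F : Type*} [Field F] [DecidableEq F] {n : ℕ} (a : Fin n → F)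
    (ha : Function.Injective a) (i : Fin n) :
    (∏ j ∈ Finset.univ.erase i, (a i - a j)) ≠ 0 := by
  rw [Finset.prod_ne_zero_iff]
  intro j hj h
  rw [sub_eq_zero] at h
  exact (Finset.ne_of_mem_erase hj) (ha h).symm

lemma coeff_sum {F : Type*} [Field F] [DecidableEq F] {n : ℕ} (a : Fin n → F)
    (ha : Function.Injective a) (P : Polynomial F) (hP : P.degree < (n : ℕ)) :
    P.coeff (n - 1) = ∑ i, P.eval (a i) / ∏ j ∈ Finset.univ.erase i, (a i - a j) := by
  have := Lagrange.coeff_eq_sum (s := Finset.univ) (v := a) ha.injOn (P := P) (by simpa using hP)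
  simpa using this

lemma degree_lt_of_moments {F : Type*} [Field F] [DecidableEq F] {n : ℕ} (a : Fin n → F)
    (ha : Function.Injective a) (h : Polynomial F) (hd : h.degree < (n : ℕ)) (k : ℕ)
    (hs : ∀ s < k, ∑ i, h.eval (a i) * a i ^ s / ∏ j ∈ Finset.univ.erase i, (a i - a j) = 0) :
    h.degree < ((n - k : ℕ) : WithBot ℕ) := by
  by_contra hcon
  by_cases h0 : h = 0
  · subst h0
    simp at hcon
  rw [Polynomial.degree_eq_natDegree h0] at hcon hd
  have hd' : h.natDegree < n := by exact_mod_cast hd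
  have hc' : n - k ≤ h.natDegree := by
    have := not_lt.mp hcon
    exact_mod_cast this
  have e := hs (n - 1 - h.natDegree) (by omega)
  have e2 := coeff_sum a ha (h * X ^ (n - 1 - h.natDegree)) (by
    rw [Polynomial.degree_mul, Polynomial.degree_X_pow, Polynomial.degree_eq_natDegree h0]
    have : h.natDegree + (n - 1 - h.natDegree) < n := by omega
    exact_mod_cast this)
  simp only [Polynomial.eval_mul, Polynomial.eval_pow, Polynomial.eval_X] at e2
  rw [e] at e2
  have e3 : n - 1 = h.natDegree + (n - 1 - h.natDegree) := by omega
  rw [e3, Polynomial.coeff_mul_X_pow'] at e2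
  simp at e2
  exact h0 e2

theorem stmt_0 (p m : ℕ) (hp : p.Prime) (hodd : p ≠ 2) (hm : 0 < m)
    (F : Type*) [Field F] [Fintype F] [DecidableEq F] (hF : Fintype.card F = p ^ m)
    (n : ℕ) (hn2 : 2 ≤ n) (hnq : n ≤ p ^ m) (hne : Even n)
    (a : Fin n → F) (ha : Function.Injective a) :
    (∃ v : Fin n → F, (∀ i, v i ≠ 0) ∧
        grsCode a v (n / 2) = dualSet (grsCode a v (n / 2))) ↔
      ((∀ i : Fin n, IsSquare (∏ j ∈ Finset.univ.erase i, (a i - a j))) ∨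
        (∀ i : Fin n, ¬ IsSquare (∏ j ∈ Finset.univ.erase i, (a i - a j)))) := by
  classical
  have hk : n - n / 2 = n / 2 := by
    obtain ⟨r, hr⟩ := hne
    omega
  have hk2 : n / 2 + n / 2 = n := by omega
  set D : Fin n → F := fun i => ∏ j ∈ Finset.univ.erase i, (a i - a j) with hD
  have hD0 : ∀ i, D i ≠ 0 := delta_ne a ha
  have hinj : Set.InjOn a (Finset.univ : Finset (Fin n)) := ha.injOn
  have interp : ∀ u : Fin n → F, ∃ h : Polynomial F, h.degree < (n : ℕ) ∧
      ∀ i, h.eval (a i) = u i := by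
    intro u
    refine ⟨Lagrange.interpolate Finset.univ a u, ?_, fun i => ?_⟩
    · simpa using Lagrange.degree_interpolate_lt u hinj
    · exact Lagrange.eval_interpolate_at_node u hinj (Finset.mem_univ i)
  have hXd : ∀ s < n / 2, ((X : Polynomial F) ^ s).degree < ((n / 2 : ℕ) : WithBot ℕ) := by
    intro s hs
    rw [Polynomial.degree_X_pow]
    exact_mod_cast hs
  constructor
  · rintro ⟨v, hv, hC⟩
    have key : ∀ s < n - 1, ∑ i, v i ^ 2 * a i ^ s = 0 := by
      intro s hs
      obtain ⟨s1, s2, h1, h2, rfl⟩ : ∃ s1 s2, s1 < n / 2 ∧ s2 < n / 2 ∧ s = s1 + s2 :=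
        ⟨min s (n / 2 - 1), s - min s (n / 2 - 1), by omega, by omega, by omega⟩
      have m1 : (fun i => v i * ((X : Polynomial F) ^ s1).eval (a i)) ∈ grsCode a v (n / 2) :=
        ⟨_, hXd s1 h1, rfl⟩
      have m2 : (fun i => v i * ((X : Polynomial F) ^ s2).eval (a i)) ∈ grsCode a v (n / 2) :=
        ⟨_, hXd s2 h2, rfl⟩
      rw [hC] at m1
      have := m1 _ m2
      rw [← this]
      refine Finset.sum_congr rfl fun i _ => ?_
      simp only [Polynomial.eval_pow, Polynomial.eval_X]
      ring
    obtain ⟨h, hd, he⟩ := interp (fun i => v i ^ 2 * D i)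
    have hlt := degree_lt_of_moments a ha h hd (n - 1) (by
      intro s hs
      rw [← key s hs]
      refine Finset.sum_congr rfl fun i _ => ?_
      rw [he i]
      change v i ^ 2 * D i * a i ^ s / D i = _
      field_simp [hD0 i])
    have hn1 : n - (n - 1) = 1 := by omega
    rw [hn1] at hlt
    have hc : h = C (h.coeff 0) := Polynomial.eq_C_of_natDegree_eq_zero (by
      by_cases h0 : h = 0
      · simp [h0]
      · have := (Polynomial.natDegree_lt_iff_degree_lt h0).2 hlt
        omega)
    have hall : ∀ i, v i ^ 2 * D i = h.coeff 0 := by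
      intro i
      rw [← he i, hc]
      simp
    have hiff : ∀ i, IsSquare (D i) ↔ IsSquare (h.coeff 0) := by
      intro i
      constructor
      · intro hi
        rw [← hall i]
        exact (IsSquare.sq (v i)).mul hi
      · intro hi
        have : D i = h.coeff 0 / v i ^ 2 := by
          rw [← hall i]
          field_simp [hv i]
        rw [this]
        exact hi.div (IsSquare.sq (v i))
    by_cases hsq : IsSquare (h.coeff 0)
    · exact Or.inl fun i => (hiff i).2 hsq
    · exact Or.inr fun i hi => hsq ((hiff i).1 hi)
  · intro hor
    obtain ⟨l, hl0, hl⟩ : ∃ l : F, l ≠ 0 ∧ ∀ i, IsSquare (l / D i) := by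
      rcases hor with h | h
      · exact ⟨1, one_ne_zero, fun i => (IsSquare.one).div (h i)⟩
      · have i0 : Fin n := ⟨0, by omega⟩
        refine ⟨D i0, hD0 i0, fun i => ?_⟩
        have q1 := (quadraticChar_neg_one_iff_not_isSquare (F := F)).2 (h i0)
        have q2 := (quadraticChar_neg_one_iff_not_isSquare (F := F)).2 (h i)
        have q3 : quadraticChar F (D i0 * D i) = 1 := by
          rw [map_mul]
          change quadraticChar F (D i0) = -1 at q1
          change quadraticChar F (D i) = -1 at q2
          rw [q1, q2]
          norm_num
        rw [quadraticChar_one_iff_isSquare (mul_ne_zero (hD0 i0) (hD0 i))] at q3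
        have : D i0 / D i = D i0 * D i / D i ^ 2 := by
          field_simp [hD0 i]
        rw [this]
        exact q3.div (IsSquare.sq _)
    choose v hv using hl
    have hv0 : ∀ i, v i ≠ 0 := by
      intro i hi
      have := hv i
      rw [hi, mul_zero] at this
      exact div_ne_zero hl0 (hD0 i) this
    refine ⟨v, hv0, Set.Subset.antisymm ?_ ?_⟩
    · rintro _ ⟨f, hf, rfl⟩ _ ⟨g, hg, rfl⟩
      have hfg : (f * g).natDegree < n - 1 ∨ f * g = 0 := by
        by_cases hf0 : f = 0
        · simp [hf0]
        by_cases hg0 : g = 0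
        · simp [hg0]
        left
        rw [Polynomial.natDegree_mul hf0 hg0]
        have h1 := (Polynomial.natDegree_lt_iff_degree_lt hf0).2 hf
        have h2 := (Polynomial.natDegree_lt_iff_degree_lt hg0).2 hg
        omega
      have hco : (f * g).coeff (n - 1) = 0 := by
        rcases hfg with h | h
        · exact Polynomial.coeff_eq_zero_of_natDegree_lt h
        · simp [h]
      have hdeg : (f * g).degree < (n : ℕ) := by
        rcases hfg with h | h
        · exact (Polynomial.degree_le_natDegree).trans_lt (by exact_mod_cast (by omega))
        · rw [h, Polynomial.degree_zero]
          exact WithBot.bot_lt_coe n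
      rw [coeff_sum a ha _ hdeg] at hco
      have : ∑ i, (v i * f.eval (a i)) * (v i * g.eval (a i)) =
          l * ∑ i, (f * g).eval (a i) / D i := by
        rw [Finset.mul_sum]
        refine Finset.sum_congr rfl fun i _ => ?_
        rw [Polynomial.eval_mul]
        calc _ = (v i * v i) * (f.eval (a i) * g.eval (a i)) := by ring
          _ = _ := by rw [← hv i]; ring
      rw [this]
      exact mul_eq_zero_of_right l hco
    · intro w hw
      obtain ⟨h, hd, he⟩ := interp (fun i => w i / v i)
      have hlt := degree_lt_of_moments a ha h hd (n / 2) (by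
        intro s hs
        have := hw _ ⟨_, hXd s hs, rfl⟩
        have e : ∑ i, w i * (v i * ((X : Polynomial F) ^ s).eval (a i)) =
            l * ∑ i, h.eval (a i) * a i ^ s / D i := by
          rw [Finset.mul_sum]
          refine Finset.sum_congr rfl fun i _ => ?_
          rw [he i, Polynomial.eval_pow, Polynomial.eval_X]
          calc _ = (v i * v i) * (w i / v i * a i ^ s) := by field_simp [hv0 i]
            _ = _ := by rw [← hv i]; ring
        rw [e] at this
        exact (mul_eq_zero.mp this).resolve_left hl0)
      rw [hk] at hlt
      refine ⟨h, hlt, funext fun i => ?_⟩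
      rw [he i]
      field_simp [hv0 i]
end

section
/- Let p be an odd prime and q = p^{2m}. Then for every even integer n with p^m + 1 ≤ n ≤ q + 1 such that n ≡ 0 (mod p^m) or n ≡ 1 (mod p^m), there exists an MDS self-dual code over F_q of length n. -/
open Finset

open Polynomial in
/-- Abstract criterion: an encoding map with the right orthogonality and weights. -/
lemma aux_code {F : Type*} [Field F] [DecidableEq F] (n k : ℕ) (hn : n = 2 * k)
    (φ : F[X] →ₗ[F] (Fin n → F))
    (orth : ∀ f g : F[X], f.degree < k → g.degree < k → ∑ i, φ f i * φ g i = 0)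
    (wt : ∀ f : F[X], f.degree < k → f ≠ 0 → k + 1 ≤ hammingNorm (φ f))
    (ex : ∃ f : F[X], f.degree < k ∧ f ≠ 0 ∧ hammingNorm (φ f) ≤ k + 1) :
    ∃ C : Submodule F (Fin n → F),
      ((C : Set (Fin n → F)) = {v | ∀ c ∈ C, ∑ i, v i * c i = 0}) ∧
      sInf {w : ℕ | ∃ c ∈ C, c ≠ 0 ∧ hammingNorm c = w} = n - n / 2 + 1 := by
  have hcard : n - n / 2 + 1 = k + 1 := by omega
  let C : Submodule F (Fin n → F) := (degreeLT F k).map φ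
  have hmem : ∀ c, c ∈ C ↔ ∃ f : F[X], f.degree < k ∧ φ f = c := by
    intro c
    simp only [C, Submodule.mem_map, mem_degreeLT]
  have hCrank : Module.finrank F C = k := by
    have hinj : Function.Injective (φ.domRestrict (degreeLT F k)) := by
      rw [← LinearMap.ker_eq_bot, LinearMap.ker_eq_bot']
      rintro ⟨f, hf⟩ h0
      by_contra hne
      have hf0 : f ≠ 0 := fun h => hne (by simp [h])
      have h1 := wt f (mem_degreeLT.1 hf) hf0
      have h2 : φ f = 0 := h0
      rw [h2, hammingNorm_zero] at h1
      omega
    have h1 := LinearMap.finrank_range_of_inj hinj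
    rw [LinearMap.range_domRestrict] at h1
    rw [h1, (degreeLTEquiv F k).finrank_eq, Module.finrank_fin_fun]
  let e := dotProductEquiv F (Fin n)
  let D : Submodule F (Fin n → F) := C.dualAnnihilator.map (e.symm : _ →ₗ[F] _)
  have hDmem : ∀ v, v ∈ D ↔ ∀ c ∈ C, ∑ i, v i * c i = 0 := by
    intro v
    simp only [D, Submodule.mem_map_equiv, Submodule.mem_dualAnnihilator]
    rfl
  have hDrank : Module.finrank F D = k := by
    have h1 := Subspace.finrank_add_finrank_dualAnnihilator_eq C
    have h2 : Module.finrank F D = Module.finrank F C.dualAnnihilator :=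
      LinearEquiv.finrank_map_eq e.symm C.dualAnnihilator
    rw [Module.finrank_fin_fun] at h1
    omega
  have hle : C ≤ D := by
    intro v hv
    rw [hDmem]
    intro c hc
    obtain ⟨f, hf, rfl⟩ := (hmem v).1 hv
    obtain ⟨g, hg, rfl⟩ := (hmem c).1 hc
    exact orth f g hf hg
  have hCD : C = D := Submodule.eq_of_le_of_finrank_eq hle (by rw [hCrank, hDrank])
  refine ⟨C, ?_, ?_⟩
  · ext v
    rw [Set.mem_setOf_eq, ← hDmem, ← hCD]
    rfl
  · rw [hcard]
    obtain ⟨f, hf, hf0, hfw⟩ := ex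
    have hw := le_antisymm hfw (wt f hf hf0)
    apply le_antisymm
    · apply Nat.sInf_le
      refine ⟨φ f, (hmem _).2 ⟨f, hf, rfl⟩, ?_, hw⟩
      intro h0
      rw [h0, hammingNorm_zero] at hw
      omega
    · apply le_csInf
      · refine ⟨_, φ f, (hmem _).2 ⟨f, hf, rfl⟩, ?_, rfl⟩
        intro h0
        rw [h0, hammingNorm_zero] at hw
        omega
      · rintro w ⟨c, hc, hc0, rfl⟩
        obtain ⟨g, hg, rfl⟩ := (hmem c).1 hc
        exact wt g hg (fun h => hc0 (by simp [h]))

lemma aux_hn {F : Type*} [Field F] [DecidableEq F] {N : ℕ} (x : Fin N → F) :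
    #{i | x i = 0} + hammingNorm x = N := by
  have := Finset.card_filter_add_card_filter_not (s := (univ : Finset (Fin N))) (fun i => x i = 0)
  simpa [hammingNorm] using this

open Polynomial in
lemma aux_wt {F : Type*} [Field F] [DecidableEq F] {N : ℕ} (α v : Fin N → F)
    (hα : Function.Injective α) (hv : ∀ i, v i ≠ 0) (f : F[X]) (hf : f ≠ 0) :
    N ≤ hammingNorm (fun i => v i * f.eval (α i)) + f.natDegree := by
  have h := aux_hn (fun i => v i * f.eval (α i))
  by_contra hlt
  apply hf
  refine eq_zero_of_degree_lt_of_eval_index_eq_zero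
    (s := ({i | v i * f.eval (α i) = 0} : Finset (Fin N))) (v := α) hα.injOn ?_ ?_
  · rw [degree_eq_natDegree hf]
    exact_mod_cast (by omega)
  · intro i hi
    simpa [hv i] using hi

open Polynomial in
lemma aux_low {F : Type*} [Field F] [DecidableEq F] {N : ℕ} (α v : Fin N → F) (d : ℕ) (hd : d ≤ N) :
    ∃ f : F[X], f.Monic ∧ f.natDegree = d ∧
      hammingNorm (fun i => v i * f.eval (α i)) ≤ N - d := by
  obtain ⟨T, -, hT⟩ := Finset.exists_subset_card_eq (s := (univ : Finset (Fin N))) (n := d) (by simpa)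
  refine ⟨Lagrange.nodal T α, Lagrange.nodal_monic, by rw [Lagrange.natDegree_nodal, hT], ?_⟩
  have h := aux_hn (fun i => v i * (Lagrange.nodal T α).eval (α i))
  have h2 : T ⊆ ({i | v i * (Lagrange.nodal T α).eval (α i) = 0} : Finset (Fin N)) := by
    intro i hi
    simp [Lagrange.eval_nodal_at_node hi]
  have := card_le_card h2
  omega

open Polynomial in
lemma aux_sum {F : Type*} [Field F] [DecidableEq F] {N : ℕ} (α v : Fin N → F) (μ : F)
    (hα : Function.Injective α)
    (hv : ∀ i, v i ^ 2 = μ * (∏ j ∈ univ.erase i, (α i - α j))⁻¹)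
    (f g : F[X]) (h : (f * g).degree < N) :
    ∑ i, (v i * f.eval (α i)) * (v i * g.eval (α i)) = μ * (f * g).coeff (N - 1) := by
  have := Lagrange.coeff_eq_sum (s := (univ : Finset (Fin N))) (v := α) hα.injOn
    (P := f * g) (by simpa using h)
  rw [card_univ, Fintype.card_fin] at this
  rw [this, mul_sum]
  refine sum_congr rfl fun i _ => ?_
  rw [eval_mul]
  linear_combination (f.eval (α i) * g.eval (α i)) * hv i

open Polynomial in
lemma aux_case0 {F : Type*} [Field F] [DecidableEq F] {n k : ℕ} (hk : 0 < k) (hn : n = 2 * k)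
    (α v : Fin n → F) (μ : F)
    (hα : Function.Injective α) (hv0 : ∀ i, v i ≠ 0)
    (hv : ∀ i, v i ^ 2 = μ * (∏ j ∈ univ.erase i, (α i - α j))⁻¹) :
    ∃ C : Submodule F (Fin n → F),
      ((C : Set (Fin n → F)) = {v | ∀ c ∈ C, ∑ i, v i * c i = 0}) ∧
      sInf {w : ℕ | ∃ c ∈ C, c ≠ 0 ∧ hammingNorm c = w} = n - n / 2 + 1 := by
  let φ : F[X] →ₗ[F] (Fin n → F) :=
    { toFun := fun f i => v i * f.eval (α i)
      map_add' := by intro f g; ext i; simp [mul_add]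
      map_smul' := by intro c f; ext i; simp; ring }
  refine aux_code n k hn φ ?_ ?_ ?_
  · intro f g hf hg
    have hlt : (f * g).degree < (n - 1 : ℕ) := by
      by_cases hf0 : f = 0
      · simp [hf0, WithBot.bot_lt_coe]
      by_cases hg0 : g = 0
      · simp [hg0, WithBot.bot_lt_coe]
      rw [degree_mul, degree_eq_natDegree hf0, degree_eq_natDegree hg0]
      rw [degree_eq_natDegree hf0] at hf
      rw [degree_eq_natDegree hg0] at hg
      norm_cast at *
      omega
    have h := aux_sum α v μ hα hv f g (hlt.trans_le (by exact_mod_cast (by omega)))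
    rw [coeff_eq_zero_of_degree_lt hlt, mul_zero] at h
    exact h
  · intro f hf hf0
    have h := aux_wt α v hα hv0 f hf0
    rw [degree_eq_natDegree hf0] at hf
    norm_cast at hf
    change k + 1 ≤ hammingNorm (fun i => v i * f.eval (α i))
    omega
  · obtain ⟨f, hf, hd, hw⟩ := aux_low α v (k - 1) (by omega)
    refine ⟨f, ?_, hf.ne_zero, ?_⟩
    · rw [degree_eq_natDegree hf.ne_zero, hd]
      exact_mod_cast (by omega)
    · change hammingNorm (fun i => v i * f.eval (α i)) ≤ k + 1
      omega

lemma aux_hn_cons {F : Type*} [Field F] [DecidableEq F] {N : ℕ} (a : F) (x : Fin N → F) :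
    hammingNorm (Fin.cons a x : Fin (N + 1) → F) = (if a = 0 then 0 else 1) + hammingNorm x := by
  simp only [hammingNorm]
  rw [Fin.card_filter_univ_succ]
  split_ifs <;> simp_all [add_comm]

open Polynomial in
lemma aux_case1 {F : Type*} [Field F] [DecidableEq F] {N k : ℕ} (hn : N + 1 = 2 * k)
    (α v : Fin N → F) (u : F) (hu : u ^ 2 = -1)
    (hα : Function.Injective α) (hv0 : ∀ i, v i ≠ 0)
    (hv : ∀ i, v i ^ 2 = 1 * (∏ j ∈ univ.erase i, (α i - α j))⁻¹) :
    ∃ C : Submodule F (Fin (N + 1) → F),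
      ((C : Set (Fin (N + 1) → F)) = {v | ∀ c ∈ C, ∑ i, v i * c i = 0}) ∧
      sInf {w : ℕ | ∃ c ∈ C, c ≠ 0 ∧ hammingNorm c = w} = (N + 1) - (N + 1) / 2 + 1 := by
  have hu0 : u ≠ 0 := by
    rintro rfl
    norm_num at hu
  let φ : F[X] →ₗ[F] (Fin (N + 1) → F) :=
    { toFun := fun f => Fin.cons (u * f.coeff (k - 1)) (fun i => v i * f.eval (α i))
      map_add' := by
        intro f g; ext i
        refine Fin.cases ?_ (fun j => ?_) i <;> simp [mul_add]
      map_smul' := by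
        intro c f; ext i
        refine Fin.cases ?_ (fun j => ?_) i <;> simp <;> ring }
  have hφ : ∀ f, φ f = Fin.cons (u * f.coeff (k - 1)) (fun i => v i * f.eval (α i)) :=
    fun f => rfl
  refine aux_code (N + 1) k hn φ ?_ ?_ ?_
  · intro f g hf hg
    have hf1 : f.natDegree ≤ k - 1 := by
      by_cases hf0 : f = 0
      · simp [hf0]
      rw [degree_eq_natDegree hf0] at hf
      norm_cast at hf
      omega
    have hg1 : g.natDegree ≤ k - 1 := by
      by_cases hg0 : g = 0
      · simp [hg0]
      rw [degree_eq_natDegree hg0] at hg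
      norm_cast at hg
      omega
    have hlt : (f * g).degree < (N : ℕ) := by
      by_cases hfg : f * g = 0
      · simp [hfg, WithBot.bot_lt_coe]
      rw [degree_eq_natDegree hfg]
      have := natDegree_mul_le (p := f) (q := g)
      exact_mod_cast (by omega)
    have h := aux_sum α v 1 hα hv f g hlt
    have hc : (f * g).coeff (N - 1) = f.coeff (k - 1) * g.coeff (k - 1) := by
      rw [show N - 1 = (k - 1) + (k - 1) by omega]
      exact coeff_mul_add_eq_of_natDegree_le hf1 hg1
    rw [Fin.sum_univ_succ]
    simp only [hφ, Fin.cons_zero, Fin.cons_succ]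
    rw [h, hc]
    linear_combination (f.coeff (k - 1) * g.coeff (k - 1)) * hu
  · intro f hf hf0
    have h := aux_wt α v hα hv0 f hf0
    rw [degree_eq_natDegree hf0] at hf
    norm_cast at hf
    rw [hφ, aux_hn_cons]
    split_ifs with hc
    · have hc' : f.coeff (k - 1) = 0 := by simpa [hu0] using hc
      have : f.natDegree ≠ k - 1 := by
        intro h2
        rw [← h2] at hc'
        exact hf0 (leadingCoeff_eq_zero.1 hc')
      omega
    · omega
  · obtain ⟨f, hf, hd, hw⟩ := aux_low α v (k - 1) (by omega)
    refine ⟨f, ?_, hf.ne_zero, ?_⟩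
    · rw [degree_eq_natDegree hf.ne_zero, hd]
      exact_mod_cast (by omega)
    · rw [hφ, aux_hn_cons]
      split_ifs <;> omega

open Polynomial in
/-- The evaluation set. -/
lemma aux_set (p m : ℕ) (hp : p.Prime) (hodd : p ≠ 2) (hm : 0 < m)
    (F : Type*) [Field F] [Fintype F] [DecidableEq F] (hF : Fintype.card F = p ^ (2 * m))
    (hchar : CharP F p) (t : ℕ) (ht : t ≤ p ^ m) :
    ∃ S : Finset F, #S = t * p ^ m ∧
      ∀ a ∈ S, (∏ b ∈ S.erase a, (a - b)) ^ (Fintype.card F / 2)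
        = ((-1) ^ ((p ^ m + 1) / 2)) ^ (t - 1) := by
  haveI : Fact p.Prime := ⟨hp⟩
  set r := p ^ m with hr
  have hrodd : Odd r := (hp.odd_of_ne_two hodd).pow
  have hr3 : 2 < r := by
    have h1 : 2 < p := lt_of_le_of_ne hp.two_le (Ne.symm hodd)
    exact lt_of_lt_of_le h1 (Nat.le_self_pow hm.ne' p)
  have hq : Fintype.card F = r * r := by rw [hF, hr]; ring
  have hr0 : (r : F) = 0 := by
    rw [hr]; push_cast; rw [CharP.cast_eq_zero, zero_pow hm.ne']
  let φ : F →+ F :=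
    { toFun := fun x => x ^ r - x
      map_zero' := by rw [zero_pow (by omega)]; simp
      map_add' := by
        intro x y
        rw [hr, add_pow_char_pow]; ring }
  have hφ : ∀ x, φ x = x ^ r - x := fun x => rfl
  have hpowq : ∀ x : F, (x ^ r) ^ r = x := by
    intro x
    rw [← pow_mul, ← hq, FiniteField.pow_card]
  have himg : ∀ x, (φ x) ^ r = - φ x := by
    intro x
    rw [hφ]
    conv_lhs => rw [hr, sub_pow_char_pow, ← hr, hpowq]
    ring
  let I : Finset F := univ.image φ
  have hI : #I ≤ r := by
    have hne : (X ^ r + X : F[X]) ≠ 0 := by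
      intro h
      have := congrArg (fun f : F[X] => f.coeff r) h
      simp [coeff_X, show ¬ (1 = r) by omega] at this
    have hsub : I ⊆ (X ^ r + X : F[X]).roots.toFinset := by
      intro y hy
      obtain ⟨x, -, rfl⟩ := mem_image.1 hy
      rw [Multiset.mem_toFinset, mem_roots hne]
      simp [himg]
    have h1 := card_le_card hsub
    have h2 := Multiset.toFinset_card_le (X ^ r + X : F[X]).roots
    have h3 := card_roots' (X ^ r + X : F[X])
    have h4 : (X ^ r + X : F[X]).natDegree ≤ r := by
      refine (natDegree_add_le _ _).trans ?_
      simp; omega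
    omega
  have hmonic : ∀ τ : F, (X ^ r - (X + C τ) : F[X]).Monic ∧
      (X ^ r - (X + C τ) : F[X]).natDegree = r := by
    intro τ
    have hlt : (X + C τ : F[X]).degree < r := by
      rw [degree_X_add_C]
      exact_mod_cast (by omega)
    refine ⟨monic_X_pow_sub hlt, ?_⟩
    rw [natDegree_sub_eq_left_of_natDegree_lt, natDegree_X_pow]
    rw [natDegree_X_pow, natDegree_X_add_C]; omega
  have hfib_le : ∀ τ : F, #{x | φ x = τ} ≤ r := by
    intro τ
    obtain ⟨h1, h2⟩ := hmonic τ
    have hsub : ({x | φ x = τ} : Finset F) ⊆ (X ^ r - (X + C τ) : F[X]).roots.toFinset := by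
      intro x hx
      rw [mem_filter, hφ] at hx
      rw [Multiset.mem_toFinset, mem_roots h1.ne_zero]
      simp only [IsRoot.def, eval_sub, eval_add, eval_pow, eval_X, eval_C]
      linear_combination hx.2
    have h3 := card_le_card hsub
    have h4 := Multiset.toFinset_card_le (X ^ r - (X + C τ) : F[X]).roots
    have h5 := card_roots' (X ^ r - (X + C τ) : F[X])
    omega
  have hsum : ∑ τ ∈ I, #{x | φ x = τ} = r * r := by
    rw [← hq, ← card_univ]
    exact (card_eq_sum_card_image φ univ).symm
  have hfibeq : ∀ τ ∈ I, #{x | φ x = τ} = #{x | φ x = 0} := by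
    intro τ hτ
    obtain ⟨x, -, rfl⟩ := mem_image.1 hτ
    exact AddMonoidHom.card_fiber_eq_of_mem_range φ ⟨x, rfl⟩ ⟨0, map_zero φ⟩
  have hprod : #I * #{x | φ x = 0} = r * r := by
    rw [← hsum, sum_congr rfl hfibeq, sum_const, smul_eq_mul]
  have hk := hfib_le 0
  have hIr : #I = r := by
    apply le_antisymm hI
    by_contra hlt
    push Not at hlt
    have : #I * #{x | φ x = 0} < r * r :=
      lt_of_le_of_lt (Nat.mul_le_mul_left _ hk) (Nat.mul_lt_mul_of_pos_right hlt (by omega))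
    omega
  have hkr : #{x | φ x = 0} = r := by
    rw [hIr] at hprod
    exact Nat.eq_of_mul_eq_mul_left (by omega) hprod
  obtain ⟨T, hTI, hT⟩ := Finset.exists_subset_card_eq (s := I) (n := t) (by omega)
  let S : Finset F := univ.filter (fun x => φ x ∈ T)
  have hS : #S = t * r := by
    have h1 : #S = ∑ τ ∈ T, #{x ∈ S | φ x = τ} := by
      apply card_eq_sum_card_fiberwise
      intro x hx
      simpa [S] using hx
    rw [h1, ← hT, ← smul_eq_mul, ← sum_const]
    apply sum_congr rfl
    intro τ hτ
    rw [← hkr, ← hfibeq τ (hTI hτ)]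
    congr 1
    ext x
    simp only [S, mem_filter, mem_univ, true_and]
    constructor
    · exact fun h => h.2
    · exact fun h => ⟨h ▸ hτ, h⟩
  refine ⟨S, hS, ?_⟩
  have hnodal : Lagrange.nodal S id = ∏ τ ∈ T, (X ^ r - (X + C τ) : F[X]) := by
    have hm2 : (∏ τ ∈ T, (X ^ r - (X + C τ) : F[X])).Monic :=
      monic_prod_of_monic _ _ fun τ _ => (hmonic τ).1
    have hd2 : (∏ τ ∈ T, (X ^ r - (X + C τ) : F[X])).natDegree = t * r := by
      rw [natDegree_prod_of_monic _ _ fun τ _ => (hmonic τ).1,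
        sum_congr rfl fun τ _ => (hmonic τ).2, sum_const, smul_eq_mul, hT]
    have hm1 : (Lagrange.nodal S (id : F → F)).Monic := Lagrange.nodal_monic
    apply eq_of_degree_le_of_eval_finset_eq S
    · rw [Lagrange.degree_nodal]
    · rw [Lagrange.degree_nodal, degree_eq_natDegree hm2.ne_zero, hd2, hS]
    · rw [hm1.leadingCoeff, hm2.leadingCoeff]
    · intro x hx
      have h0 : eval x (Lagrange.nodal S (id : F → F)) = 0 :=
        Lagrange.eval_nodal_at_node (v := (id : F → F)) hx
      rw [h0, eval_prod]
      symm
      apply prod_eq_zero (i := φ x)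
      · simpa [S] using hx
      · simp only [eval_sub, eval_add, eval_pow, eval_X, eval_C, hφ]
        ring
  intro a ha
  have haT : φ a ∈ T := by simpa [S] using ha
  have hder : ∏ b ∈ S.erase a, (a - b) = - ∏ τ ∈ T.erase (φ a), (φ a - τ) := by
    have h1 := Lagrange.eval_nodal_derivative_eval_node_eq (v := (id : F → F)) ha
    rw [Lagrange.eval_nodal] at h1
    simp only [id] at h1
    rw [← h1]
    change eval a (derivative (Lagrange.nodal S (id : F → F))) = _
    rw [hnodal, ← mul_prod_erase _ _ haT, derivative_mul]
    simp only [eval_add, eval_mul, eval_prod, derivative_sub, derivative_add, derivative_X_pow,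
      derivative_X, derivative_C, eval_sub, eval_pow, eval_X, eval_C, hr0, map_zero, eval_zero,
      eval_one, eval_natCast]
    have e1 : ∀ τ, a ^ r - (a + τ) = φ a - τ := fun τ => by rw [hφ]; ring
    simp only [e1]
    ring
  have hhalf : Fintype.card F / 2 = (r - 1) * ((r + 1) / 2) := by
    rw [hq]
    obtain ⟨s, hs⟩ := hrodd
    rw [hs, show 2 * s + 1 - 1 = 2 * s by omega, show (2 * s + 1 + 1) / 2 = s + 1 by omega,
      show (2 * s + 1) * (2 * s + 1) = 1 + 2 * (2 * s * (s + 1)) by ring]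
    omega
  have heven : Even (r - 1) := by
    obtain ⟨s, hs⟩ := hrodd
    exact ⟨s, by omega⟩
  rw [hder, neg_pow, hhalf]
  have e1 : ((-1 : F)) ^ ((r - 1) * ((r + 1) / 2)) = 1 := by
    rw [pow_mul, heven.neg_one_pow, one_pow]
  rw [e1, one_mul, ← prod_pow]
  have e2 : ∀ τ ∈ T.erase (φ a),
      (φ a - τ) ^ ((r - 1) * ((r + 1) / 2)) = (-1) ^ ((r + 1) / 2) := by
    intro τ hτ
    rw [mem_erase] at hτ
    obtain ⟨b, -, hb⟩ := mem_image.1 (hTI hτ.2)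
    have hd : φ a - τ ≠ 0 := sub_ne_zero.2 (Ne.symm hτ.1)
    have h1 : (φ a - τ) ^ r = - (φ a - τ) := by
      rw [← hb, ← map_sub, himg]
    have h2 : (φ a - τ) ^ (r - 1) = -1 := by
      apply mul_right_cancel₀ hd
      rw [← pow_succ, show r - 1 + 1 = r by omega, h1]
      ring
    rw [pow_mul, h2]
  rw [prod_congr rfl e2, prod_const, card_erase_of_mem haT, hT]

/-- Enumerating the evaluation set. -/
lemma aux_enum {F : Type*} [Field F] [DecidableEq F] (S : Finset F) (N : ℕ) (hS : #S = N) :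
    ∃ α : Fin N → F, Function.Injective α ∧ (∀ i, α i ∈ S) ∧
      ∀ i, ∏ j ∈ univ.erase i, (α i - α j) = ∏ b ∈ S.erase (α i), (α i - b) := by
  let e := S.equivFinOfCardEq hS
  have hinj : Function.Injective (fun i => (e.symm i : F)) :=
    Subtype.val_injective.comp e.symm.injective
  refine ⟨fun i => (e.symm i : F), hinj, fun i => (e.symm i).2, fun i => ?_⟩
  have himg : S.erase (e.symm i : F) = (univ.erase i).image (fun i => (e.symm i : F)) := by
    ext b
    simp only [mem_erase, mem_image, mem_univ, and_true]
    constructor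
    · rintro ⟨h1, h2⟩
      refine ⟨e ⟨b, h2⟩, ?_, by simp⟩
      rintro rfl
      simp at h1
    · rintro ⟨j, h1, rfl⟩
      exact ⟨fun h => h1 (hinj h), (e.symm j).2⟩
  rw [himg, prod_image (fun x _ y _ h => hinj h)]

theorem stmt_8 (p m : ℕ) (hp : p.Prime) (hodd : p ≠ 2) (hm : 0 < m)
    (F : Type*) [Field F] [Fintype F] [DecidableEq F] (hF : Fintype.card F = p ^ (2 * m))
    (n : ℕ) (hne : Even n) (hlow : p ^ m + 1 ≤ n) (hhigh : n ≤ p ^ (2 * m) + 1)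
    (hmod : n % p ^ m = 0 ∨ n % p ^ m = 1) :
    ∃ C : Submodule F (Fin n → F),
      -- C is self-dual
      ((C : Set (Fin n → F)) = {v | ∀ c ∈ C, ∑ i, v i * c i = 0}) ∧
      -- C is MDS: its minimum Hamming distance equals n − k + 1 with k = n/2
      sInf {w : ℕ | ∃ c ∈ C, c ≠ 0 ∧ hammingNorm c = w} = n - n / 2 + 1 := by
  haveI : Fact p.Prime := ⟨hp⟩
  have hchar : CharP F p := by
    obtain ⟨p', hp'⟩ := CharP.exists F
    obtain ⟨k, hk, hc⟩ := FiniteField.card F p'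
    have h1 : p' ∣ p ^ (2 * m) := by
      rw [← hF, hc]
      exact dvd_pow_self p' k.ne_zero
    have h2 : p' = p := (Nat.prime_dvd_prime_iff_eq hk hp).1 (hk.dvd_of_dvd_pow h1)
    exact h2 ▸ hp'
  have hring : ringChar F ≠ 2 := by
    rw [ringChar.eq F p]
    exact hodd
  have hrodd : Odd (p ^ m) := (hp.odd_of_ne_two hodd).pow
  have hr1 : 2 < p ^ m := by
    have h1 : 2 < p := lt_of_le_of_ne hp.two_le (Ne.symm hodd)
    exact lt_of_lt_of_le h1 (Nat.le_self_pow hm.ne' p)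
  have hrr : p ^ (2 * m) = p ^ m * p ^ m := by ring
  obtain ⟨k, hk⟩ := hne
  have hk2 : n = 2 * k := by omega
  have hdiv := Nat.div_add_mod n (p ^ m)
  set t := n / p ^ m with ht_def
  have htle : t ≤ p ^ m := by
    by_contra h
    push Not at h
    have : p ^ m * (p ^ m + 1) ≤ p ^ m * t := Nat.mul_le_mul_left _ h
    rw [mul_add, mul_one] at this
    omega
  obtain ⟨S, hScard, hS⟩ := aux_set p m hp hodd hm F hF hchar t htle
  set ε : F := ((-1) ^ ((p ^ m + 1) / 2)) ^ (t - 1) with hε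
  have hεsq : ε * ε = 1 := by
    rw [hε, ← mul_pow, ← mul_pow]
    simp
  have hprod0 : ∀ a ∈ S, ∏ b ∈ S.erase a, (a - b) ≠ 0 := by
    intro a _
    rw [prod_ne_zero_iff]
    intro b hb
    exact sub_ne_zero.2 (Ne.symm (mem_erase.1 hb).1)
  rcases hmod with h0 | h1
  · obtain ⟨α, hα, hαS, hαp⟩ := aux_enum S n (by rw [hScard]; nlinarith)
    let i0 : Fin n := ⟨0, by omega⟩
    let μ : F := ∏ b ∈ S.erase (α i0), (α i0 - b)
    have hμ0 : μ ≠ 0 := hprod0 _ (hαS i0)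
    have hsq : ∀ i, ∃ v : F, v ^ 2 = μ * (∏ j ∈ univ.erase i, (α i - α j))⁻¹ := by
      intro i
      have hne : μ * (∏ j ∈ univ.erase i, (α i - α j))⁻¹ ≠ 0 := by
        rw [hαp]
        exact mul_ne_zero hμ0 (inv_ne_zero (hprod0 _ (hαS i)))
      have : IsSquare (μ * (∏ j ∈ univ.erase i, (α i - α j))⁻¹) := by
        rw [FiniteField.isSquare_iff hring hne, mul_pow, inv_pow, hαp, hS _ (hαS i),
          hS _ (hαS i0)]
        exact mul_inv_cancel₀ (left_ne_zero_of_mul_eq_one hεsq)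
      obtain ⟨v, hv⟩ := this
      exact ⟨v, by rw [hv]; ring⟩
    choose v hv using hsq
    refine aux_case0 (k := k) (by omega) hk2 α v μ hα ?_ hv
    intro i hvi
    have h := hv i
    rw [hvi, hαp] at h
    exact mul_ne_zero hμ0 (inv_ne_zero (hprod0 _ (hαS i))) (by rw [← h]; ring)
  · obtain ⟨N, rfl⟩ : ∃ N, n = N + 1 := ⟨n - 1, by omega⟩
    have hN : N = p ^ m * t := by omega
    have hNodd : Odd N := ⟨k - 1, by omega⟩
    have htodd : Odd t := by
      rw [hN] at hNodd
      exact (Nat.odd_mul.1 hNodd).2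
    have hε1 : ε = 1 := by
      obtain ⟨s, hs⟩ := htodd
      rw [hε, hs, show 2 * s + 1 - 1 = 2 * s by omega, pow_mul, ← pow_mul _ _ 2, mul_comm _ 2, pow_mul,
        neg_one_sq, one_pow, one_pow]
    obtain ⟨α, hα, hαS, hαp⟩ := aux_enum S N (by rw [hScard, hN]; ring)
    have hsq : ∀ i, ∃ v : F, v ^ 2 = 1 * (∏ j ∈ univ.erase i, (α i - α j))⁻¹ := by
      intro i
      have hne : 1 * (∏ j ∈ univ.erase i, (α i - α j))⁻¹ ≠ 0 := by
        rw [hαp, one_mul]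
        exact inv_ne_zero (hprod0 _ (hαS i))
      have : IsSquare (1 * (∏ j ∈ univ.erase i, (α i - α j))⁻¹) := by
        rw [FiniteField.isSquare_iff hring hne, one_mul, inv_pow, hαp, hS _ (hαS i), hε1, inv_one]
      obtain ⟨v, hv⟩ := this
      exact ⟨v, by rw [hv]; ring⟩
    choose v hv using hsq
    have hu : ∃ u : F, u ^ 2 = -1 := by
      have : IsSquare (-1 : F) := by
        rw [FiniteField.isSquare_neg_one_iff, hF, hrr]
        obtain ⟨s, hs⟩ := hrodd
        rw [hs, show (2 * s + 1) * (2 * s + 1) = 1 + 4 * (s * (s + 1)) by ring]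
        omega
      obtain ⟨u, hu⟩ := this
      exact ⟨u, by rw [hu]; ring⟩
    obtain ⟨u, hu⟩ := hu
    refine aux_case1 (k := k) hk2 α v u hu hα ?_ hv
    intro i hvi
    have h := hv i
    rw [hvi, hαp, one_mul] at h
    exact inv_ne_zero (hprod0 _ (hαS i)) (by rw [← h]; ring)
end

section
/- Let p be an odd prime, q = p^m, and Q = q^l with l ≥ 1. If n is an odd integer with 1 ≤ n ≤ q and n + 1 belongs to Σ(eg, q), then n·q^{l−1} + 1 belongs to Σ(eg, Q). -/
open Finset

/-- Δ_S(a) = ∏_{b ∈ S, b ≠ a} (a − b). -/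
def deltaS {F : Type*} [Field F] [DecidableEq F] (S : Finset F) (a : F) : F :=
  ∏ b ∈ S.erase a, (a - b)

/-- n ∈ Σ(eg,q): n is even, n ≥ 2, and there is S ⊆ F_q with |S| = n − 1 such that
η_q(−Δ_S(a)) = 1, i.e. −Δ_S(a) is a square, for all a ∈ S. -/
def SigmaEG (F : Type*) [Field F] [DecidableEq F] (n : ℕ) : Prop :=
  Even n ∧ 2 ≤ n ∧ ∃ S : Finset F, S.card = n - 1 ∧
    ∀ a ∈ S, IsSquare (-(deltaS S a))

open Polynomial in
lemma trP_monic {K : Type*} [Field K] (q k : ℕ) (hq : 1 < q) :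
    (∑ i ∈ range (k + 1), (X : K[X]) ^ q ^ i).Monic ∧
    (∑ i ∈ range (k + 1), (X : K[X]) ^ q ^ i).natDegree = q ^ k := by
  have hd : (∑ i ∈ range k, (X : K[X]) ^ q ^ i).degree < ((q ^ k : ℕ) : WithBot ℕ) := by
    refine lt_of_le_of_lt (degree_sum_le _ _) ?_
    rw [Finset.sup_lt_iff (WithBot.bot_lt_coe _)]
    intro i hi
    rw [degree_X_pow]
    exact_mod_cast Nat.pow_lt_pow_right hq (Finset.mem_range.mp hi)
  rw [Finset.sum_range_succ, add_comm]
  constructor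
  · exact monic_X_pow_add hd
  · rw [natDegree_add_eq_left_of_degree_lt, natDegree_X_pow]
    rwa [degree_X_pow]

open Polynomial in
lemma core {F K : Type*} [Field F] [Fintype F] [DecidableEq F] [Field K] [Fintype K]
    [DecidableEq K] [Algebra F K] (k : ℕ)
    (hK : Fintype.card K = Fintype.card F ^ (k + 1)) (S : Finset F) :
    ∃ T : Finset K, T.card = S.card * Fintype.card F ^ k ∧
      ∀ a ∈ T, ∃ s ∈ S, deltaS T a = algebraMap F K (deltaS S s) := by
  classical
  have hq : 1 < Fintype.card F := Fintype.one_lt_card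
  have hfr : Module.finrank F K = k + 1 := by
    have := Module.card_eq_pow_finrank (K := F) (V := K)
    rw [hK] at this
    exact (Nat.pow_right_injective hq this).symm
  have htr : ∀ x : K, algebraMap F K (Algebra.trace F K x) =
      (∑ i ∈ range (k + 1), (X : K[X]) ^ Fintype.card F ^ i).eval x := by
    intro x
    rw [FiniteField.algebraMap_trace_eq_sum_pow, hfr, eval_finsetSum]
    simp [Nat.card_eq_fintype_card]
  have hsurj : Function.Surjective (Algebra.trace F K) := Algebra.trace_surjective F K
  obtain ⟨hmon, hdeg⟩ := trP_monic (K := K) (Fintype.card F) k hq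
  have hder : derivative (∑ i ∈ range (k + 1), (X : K[X]) ^ Fintype.card F ^ i) = 1 := by
    rw [Finset.sum_range_succ', derivative_add, derivative_sum, Finset.sum_eq_zero]
    · simp
    · intro i _
      have : ((Fintype.card F : ℕ) : K) = 0 := by
        rw [← map_natCast (algebraMap F K), FiniteField.cast_card_eq_zero, map_zero]
      rw [derivative_X_pow]
      simp [this]
  set P := ∑ i ∈ range (k + 1), (X : K[X]) ^ Fintype.card F ^ i with hP
  have hfib : ∀ s : F, (univ.filter fun x : K => Algebra.trace F K x = s).card
      = Fintype.card F ^ k := by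
    have h1 : ∀ s : F, (univ.filter fun x : K => Algebra.trace F K x = s).card
      = (univ.filter fun x : K => Algebra.trace F K x = 0).card := fun s =>
      AddMonoidHom.card_fiber_eq_of_mem_range (Algebra.trace F K) (hsurj s) (hsurj 0)
    have h2 := Finset.card_eq_sum_card_fiberwise (f := Algebra.trace F K) (s := univ)
      (t := univ) (fun _ _ => by simp)
    rw [Finset.sum_congr rfl (fun s _ => h1 s), Finset.sum_const, Finset.card_univ,
      Finset.card_univ, hK, pow_succ', smul_eq_mul] at h2
    intro s
    rw [h1 s]
    exact (Nat.eq_of_mul_eq_mul_left (by omega) h2).symm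
  set T := univ.filter fun x : K => Algebra.trace F K x ∈ S with hT
  have hTc : T.card = S.card * Fintype.card F ^ k := by
    rw [Finset.card_eq_sum_card_fiberwise (f := Algebra.trace F K) (t := S)
      (fun x hx => by simpa [hT] using hx)]
    rw [← smul_eq_mul, ← Finset.sum_const]
    refine Finset.sum_congr rfl fun s hs => ?_
    rw [← hfib s]
    congr 1
    ext x
    simp only [hT, Finset.mem_filter, Finset.mem_univ, true_and]
    constructor
    · exact fun h => h.2
    · rintro rfl; exact ⟨hs, rfl⟩
  refine ⟨T, hTc, fun a ha => ⟨Algebra.trace F K a, by simpa [hT] using ha, ?_⟩⟩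
  have haS : Algebra.trace F K a ∈ S := by simpa [hT] using ha
  have hP0 : P.natDegree ≠ 0 := by rw [hdeg]; positivity
  have key : (Lagrange.nodal S (algebraMap F K)).comp P = Lagrange.nodal T id := by
    refine Polynomial.eq_of_monic_of_dvd_of_natDegree_le Lagrange.nodal_monic
      (Lagrange.nodal_monic.comp hmon hP0) ?_ ?_
    · rw [Lagrange.nodal]
      refine Finset.prod_dvd_of_coprime ?_ ?_
      · intro x _ y _ hxy
        exact isCoprime_X_sub_C_of_isUnit_sub (sub_ne_zero.mpr hxy).isUnit
      · intro x hx
        rw [dvd_iff_isRoot, IsRoot, eval_comp, id, ← htr]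
        exact Lagrange.eval_nodal_at_node (by simpa [hT] using hx)
    · rw [natDegree_comp, Lagrange.natDegree_nodal, Lagrange.natDegree_nodal, hdeg, hTc]
  have h3 := Lagrange.eval_nodal_derivative_eval_node_eq (v := id) ha
  rw [← key, derivative_comp, hder, one_mul, eval_comp, id, ← htr,
    Lagrange.eval_nodal_derivative_eval_node_eq haS, Lagrange.eval_nodal,
    Lagrange.eval_nodal] at h3
  simp only [deltaS, map_prod, map_sub]
  exact h3.symm

theorem stmt_16 (p m l : ℕ) (hp : p.Prime) (hodd : p ≠ 2) (hm : 0 < m) (hl : 1 ≤ l)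
    (q : ℕ) (hq : q = p ^ m)
    (F K : Type*) [Field F] [Fintype F] [DecidableEq F] [Field K] [Fintype K] [DecidableEq K]
    (hF : Fintype.card F = q) (hK : Fintype.card K = q ^ l)
    (n : ℕ) (hno : Odd n) (hn1 : 1 ≤ n) (hnq : n ≤ q)
    (h : SigmaEG F (n + 1)) :
    SigmaEG K (n * q ^ (l - 1) + 1) := by
  obtain ⟨k, rfl⟩ : ∃ k, l = k + 1 := ⟨l - 1, by omega⟩
  have hqo : Odd q := hq ▸ (hp.odd_of_ne_two hodd).pow
  haveI : Fact p.Prime := ⟨hp⟩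
  have hFp : Fintype.card F = p ^ m := by rw [hF, hq]
  have hKp : Fintype.card K = p ^ (m * (k + 1)) := by rw [hK, hq, pow_mul]
  haveI : CharP F p := charP_of_card_eq_prime_pow hFp
  haveI : CharP K p := charP_of_card_eq_prime_pow hKp
  letI : Algebra (ZMod p) F := ZMod.algebra F p
  letI : Algebra (ZMod p) K := ZMod.algebra K p
  have e1 : Module.finrank (ZMod p) F = m :=
    Nat.pow_right_injective hp.two_le ((FiniteField.pow_finrank_eq_card p F).trans hFp)
  have e2 : Module.finrank (ZMod p) K = m * (k + 1) :=
    Nat.pow_right_injective hp.two_le ((FiniteField.pow_finrank_eq_card p K).trans hKp)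
  obtain ⟨f⟩ := FiniteField.nonempty_algHom_of_finrank_dvd (F := ZMod p) (K := F) (L := K)
    (by rw [e1, e2]; exact dvd_mul_right _ _)
  letI : Algebra F K := f.toRingHom.toAlgebra
  obtain ⟨_, _, S, hS, hsq⟩ := h
  obtain ⟨T, hT, hTS⟩ := core (F := F) (K := K) k (by rw [hK, hF]) S
  rw [Nat.add_sub_cancel] at hS
  have hpos : 0 < n * q ^ k := Nat.mul_pos hn1 (pow_pos hqo.pos _)
  simp only [Nat.add_sub_cancel]
  refine ⟨(hno.mul hqo.pow).add_one, by omega, T, by rw [hT, hS, hF]; simp, ?_⟩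
  intro a ha
  obtain ⟨s, hs, hd⟩ := hTS a ha
  rw [hd, ← map_neg]
  exact (hsq s hs).map (algebraMap F K)
end
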